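/- arXiv:2201.00872 — 2 statements merged into one kernel-verified Lean document; each statement's English description precedes it below -/
import Mathlib

section
/- Let A be a finite alphabet. Any language L ⊆ A* which satisfies the families of ultrafilter equations E_{ab=ba}, E_{aab=abb} and E_{a=a·a} for all letters a, b ∈ A belongs to B₁. -/
open Set

namespace Stmt2

/-- Membership in the Boolean subalgebra of `Set α` generated by a family `S`. -/
inductive GenBool {α : Type*} (S : Set (Set α)) : Set α → Prop
  | basic {s : Set α} : s ∈ S → GenBool S s
  | univ : GenBool S Set.univ
  | compl {s : Set α} : GenBool S s → GenBool S sᶜ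
  | inter {s t : Set α} : GenBool S s → GenBool S t → GenBool S (s ∩ t)

variable {A : Type*}

/-- `c_a(w)`: the set of positions of the word `w` carrying the letter `a`. -/
def contentSet (a : A) (w : List A) : Set ℕ :=
  {i | ∃ h : i < w.length, w.get ⟨i, h⟩ = a}

/-- `L_{◇^a_Q}`. -/
def diamLang (a : A) (Q : Set ℕ) : Set (List A) :=
  {w | (contentSet a w ∩ Q).Nonempty}

/-- The Boolean algebra `B₁`, as a membership predicate. -/
def B1 (A : Type*) : Set (List A) → Prop :=
  GenBool {L | ∃ (a : A) (Q : Set ℕ), L = diamLang a Q}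

/-- `A* ⊗ ℕ`. -/
abbrev Dom1 (A : Type*) : Type _ := {x : List A × ℕ // x.2 < x.1.length}

/-- `A* ⊗ ℕ²`. -/
abbrev Dom2 (A : Type*) : Type _ :=
  {x : List A × ℕ × ℕ // x.2.1 < x.1.length ∧ x.2.2 < x.1.length}

/-- `A* ⊗ ℕ³`. -/
abbrev Dom3 (A : Type*) : Type _ :=
  {x : List A × ℕ × ℕ × ℕ //
    x.2.1 < x.1.length ∧ x.2.2.1 < x.1.length ∧ x.2.2.2 < x.1.length}

/-- `f_{a,b}(w,j₁,j₂) = w(j₁→a)(j₂→b)` if `j₁ ≠ j₂`, and `w` otherwise. -/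
def f2 (a b : A) : Dom2 A → List A := fun x =>
  if x.1.2.1 ≠ x.1.2.2 then (x.1.1.set x.1.2.1 a).set x.1.2.2 b else x.1.1

/-- `f_{a,b,c}(w,j₁,j₂,j₃) = w(j₁→a)(j₂→b)(j₃→c)` if `j₁,j₂,j₃` are pairwise
distinct, and `w` otherwise. -/
def f3 (a b c : A) : Dom3 A → List A := fun x =>
  if x.1.2.1 ≠ x.1.2.2.1 ∧ x.1.2.1 ≠ x.1.2.2.2 ∧ x.1.2.2.1 ≠ x.1.2.2.2 then
    ((x.1.1.set x.1.2.1 a).set x.1.2.2.1 b).set x.1.2.2.2 c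
  else x.1.1

/-- `f_a(w,i) = w(i→a)`. -/
def f1 (a : A) : Dom1 A → List A := fun x => x.1.1.set x.1.2 a

/-- `f_a·a(w,i) = w(i→a).a`. -/
def f1app (a : A) : Dom1 A → List A := fun x => x.1.1.set x.1.2 a ++ [a]

/-- `L` satisfies the family of ultrafilter equations `E_{ab=ba}`. -/
def SatAB (L : Set (List A)) (a b : A) : Prop :=
  ∀ ν : Ultrafilter (Dom2 A),
    Ultrafilter.map (fun x => x.1.2.1) ν = Ultrafilter.map (fun x => x.1.2.2) ν →
      (f2 a b ⁻¹' L ∈ ν ↔ f2 b a ⁻¹' L ∈ ν)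

/-- `L` satisfies the family of ultrafilter equations `E_{aab=abb}`. -/
def SatAAB (L : Set (List A)) (a b : A) : Prop :=
  ∀ ν : Ultrafilter (Dom3 A),
    (Ultrafilter.map (fun x => x.1.2.1) ν = Ultrafilter.map (fun x => x.1.2.2.1) ν ∧
      Ultrafilter.map (fun x => x.1.2.2.1) ν = Ultrafilter.map (fun x => x.1.2.2.2) ν) →
      (f3 a a b ⁻¹' L ∈ ν ↔ f3 a b b ⁻¹' L ∈ ν)

/-- `L` satisfies the family of ultrafilter equations `E_{a=a·a}`. -/
def SatAA (L : Set (List A)) (a : A) : Prop :=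
  ∀ ν : Ultrafilter (Dom1 A),
    Ultrafilter.map (fun x => x.1.2) ν = Ultrafilter.map (fun x => x.1.1.length) ν →
      (f1 a ⁻¹' L ∈ ν ↔ f1app a ⁻¹' L ∈ ν)

/-- A Boolean algebra of sets contains every set that is determined by membership in
finitely many of its elements. -/
theorem genBool_of_determined {α ι : Type*} {S : Set (Set α)} {D : ι → Set α} (t : Finset ι)
    (hD : ∀ i ∈ t, GenBool S (D i)) (L : Set α)
    (hL : ∀ x y, (∀ i ∈ t, x ∈ D i ↔ y ∈ D i) → (x ∈ L ↔ y ∈ L)) : GenBool S L := by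
  classical
  induction t using Finset.induction_on generalizing L with
  | empty =>
    rcases L.eq_empty_or_nonempty with rfl | ⟨x, hx⟩
    · simpa using (GenBool.univ (S := S)).compl
    · rw [Set.eq_univ_of_forall fun y => (hL x y (by simp)).1 hx]
      exact .univ
  | insert i t _ ih =>
    have hDi := hD i (Finset.mem_insert_self i t)
    have key (E : Set α) : GenBool S {x | ∃ y ∈ L ∩ E, ∀ k ∈ t, x ∈ D k ↔ y ∈ D k} := by
      refine ih (fun k hk => hD k (Finset.mem_insert_of_mem hk)) _ fun x y hxy => ?_
      exact exists_congr fun z => and_congr_right fun _ =>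
        forall₂_congr fun k hk => by rw [hxy k hk]
    have hunion : L = ((D i ∩ {x | ∃ y ∈ L ∩ D i, ∀ k ∈ t, x ∈ D k ↔ y ∈ D k})ᶜ ∩
        ((D i)ᶜ ∩ {x | ∃ y ∈ L ∩ (D i)ᶜ, ∀ k ∈ t, x ∈ D k ↔ y ∈ D k})ᶜ)ᶜ := by
      ext x
      rw [← Set.compl_union, compl_compl]
      constructor
      · intro hx
        by_cases hxi : x ∈ D i
        · exact .inl ⟨hxi, x, ⟨hx, hxi⟩, fun _ _ => Iff.rfl⟩
        · exact .inr ⟨hxi, x, ⟨hx, hxi⟩, fun _ _ => Iff.rfl⟩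
      · rintro (⟨hxi, y, ⟨hy, hyi⟩, h⟩ | ⟨hxi, y, ⟨hy, hyi⟩, h⟩)
        · exact (hL x y (Finset.forall_mem_insert _ _ _ |>.2 ⟨iff_of_true hxi hyi, h⟩)).2 hy
        · exact (hL x y (Finset.forall_mem_insert _ _ _ |>.2 ⟨iff_of_false hxi hyi, h⟩)).2 hy
    rw [hunion]
    exact ((hDi.inter (key _)).compl.inter (hDi.compl.inter (key _)).compl).compl

/-- If every ultrafilter containing all the sets `E Q` satisfies the equation `u = v` on `L`,
then finitely many of the sets `E Q` suffice to force `u x ∈ L ↔ v x ∈ L`. -/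
theorem exists_finset_forall_mem_iff {X Y ι : Type*} {E : ι → Set X} {u v : X → Y} {L : Set Y}
    (h : ∀ ν : Ultrafilter X, (∀ Q, E Q ∈ ν) → (u ⁻¹' L ∈ ν ↔ v ⁻¹' L ∈ ν)) :
    ∃ F : Finset ι, ∀ x, (∀ Q ∈ F, x ∈ E Q) → (u x ∈ L ↔ v x ∈ L) := by
  have hmem : {x | u x ∈ L ↔ v x ∈ L} ∈ ⨅ Q, Filter.principal (E Q) := by
    rw [Filter.mem_iff_ultrafilter]
    intro ν hν
    have hiff := h ν fun Q => Filter.le_principal_iff.1 (hν.trans (iInf_le _ Q))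
    by_cases hu : u ⁻¹' L ∈ ν
    · filter_upwards [hu, hiff.1 hu] with x hx hx'
      exact iff_of_true hx hx'
    · have hv := mt hiff.2 hu
      rw [← Ultrafilter.compl_mem_iff_notMem] at hu hv
      filter_upwards [hu, hv] with x hx hx'
      exact iff_of_false hx hx'
  obtain ⟨F, hF⟩ := Filter.mem_iInf_finite _ |>.1 hmem
  rw [Filter.iInf_principal_finset, Filter.mem_principal] at hF
  exact ⟨F, fun x hx => hF (Set.mem_iInter₂.2 hx)⟩

theorem map_eq_map_of_forall_mem {X Y : Type*} {ν : Ultrafilter X} {p q : X → Y}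
    (h : ∀ Q : Set Y, {x | p x ∈ Q ↔ q x ∈ Q} ∈ ν) : Ultrafilter.map p ν = Ultrafilter.map q ν := by
  ext Q
  rw [Ultrafilter.mem_map, Ultrafilter.mem_map]
  exact Filter.eventually_congr (h Q)

theorem mem_contentSet {a : A} {w : List A} {i : ℕ} : i ∈ contentSet a w ↔ w[i]? = some a :=
  List.getElem?_eq_some_iff.symm

/-- The letter `a` occurs in `w` at a position of colour `c`. -/
def Occurs {C : Type*} (χ : ℕ → C) (w : List A) (a : A) (c : C) : Prop :=
  ∃ i, χ i = c ∧ w[i]? = some a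

/-- Membership in `L` is unaffected by exchanging the letters at two positions of the same
colour. -/
def SwapInvariant {C : Type*} (χ : ℕ → C) (L : Set (List A)) : Prop :=
  ∀ (w : List A) (i j : ℕ) (a b : A), i ≠ j → χ i = χ j → w[i]? = some a → w[j]? = some b →
    (w ∈ L ↔ (w.set i b).set j a ∈ L)

/-- Membership in `L` is unaffected by replacing a letter with another one when both occur
elsewhere at positions of the same colour. -/
def ReplaceInvariant {C : Type*} (χ : ℕ → C) (L : Set (List A)) : Prop :=
  ∀ (w : List A) (i j k : ℕ) (a b : A), i ≠ j → i ≠ k → j ≠ k → χ i = χ j → χ j = χ k →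
    w[i]? = some a → w[j]? = some a → w[k]? = some b → (w ∈ L ↔ w.set j b ∈ L)

/-- Membership in `L` is unaffected by appending a letter that already occurs at the colour of
the new position. -/
def AppendInvariant {C : Type*} (χ : ℕ → C) (L : Set (List A)) : Prop :=
  ∀ (w : List A) (i : ℕ) (a : A), χ i = χ w.length → w[i]? = some a → (w ∈ L ↔ w ++ [a] ∈ L)

section Colouring

variable {C : Type*} {χ : ℕ → C} {L : Set (List A)} {w w' : List A}

theorem getElem?_set_set_eq_swap {i j : ℕ} {a b : A} (hi : w[i]? = some a) (hj : w[j]? = some b)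
    (k : ℕ) : ((w.set i b).set j a)[k]? = w[Equiv.swap i j k]? := by
  have hi' := (List.getElem?_eq_some_iff.1 hi).1
  have hj' := (List.getElem?_eq_some_iff.1 hj).1
  rw [Equiv.swap_apply_def]
  grind

theorem occurs_swap_iff {i j : ℕ} {a b : A} (hχ : χ i = χ j) (hi : w[i]? = some a)
    (hj : w[j]? = some b) (e : A) (c : C) :
    Occurs χ ((w.set i b).set j a) e c ↔ Occurs χ w e c := by
  have hcol (k : ℕ) : χ (Equiv.swap i j k) = χ k := by
    rw [Equiv.swap_apply_def]
    grind
  constructor <;> rintro ⟨k, hk, hw⟩ <;> refine ⟨Equiv.swap i j k, (hcol k).trans hk, ?_⟩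
  · rwa [← getElem?_set_set_eq_swap hi hj]
  · rwa [getElem?_set_set_eq_swap hi hj, Equiv.swap_apply_self]

theorem occurs_set_iff {i j k : ℕ} {a b : A} (hij : i ≠ j) (hχ : χ i = χ j)
    (hχ' : χ j = χ k) (hi : w[i]? = some a) (hj : w[j]? = some a) (hk : w[k]? = some b)
    (e : A) (c : C) : Occurs χ (w.set j b) e c ↔ Occurs χ w e c := by
  constructor
  · rintro ⟨l, hl, hw⟩
    by_cases hlj : l = j
    · exact ⟨k, by grind, by grind⟩
    · exact ⟨l, hl, by grind⟩
  · rintro ⟨l, hl, hw⟩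
    by_cases hlj : l = j
    · exact ⟨i, by grind, by grind⟩
    · exact ⟨l, hl, by grind⟩

theorem occurs_append_iff {i : ℕ} {a : A} (hχ : χ i = χ w.length) (hi : w[i]? = some a)
    (e : A) (c : C) : Occurs χ (w ++ [a]) e c ↔ Occurs χ w e c := by
  constructor
  · rintro ⟨l, hl, hw⟩
    by_cases hlw : l < w.length
    · exact ⟨l, hl, by grind⟩
    · exact ⟨i, by grind, by grind⟩
  · rintro ⟨l, hl, hw⟩
    exact ⟨l, hl, by grind⟩

/-- Words of equal length with the same letters in every colour class are equivalent: moving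
along swaps and replacements strictly decreases the Hamming distance. -/
theorem mem_iff_of_length_eq (hswap : SwapInvariant χ L) (hrep : ReplaceInvariant χ L)
    (hlen : w.length = w'.length) (h : ∀ a c, Occurs χ w a c ↔ Occurs χ w' a c) :
    w ∈ L ↔ w' ∈ L := by
  classical
  induction hd : ((Finset.range w'.length).filter fun i => w[i]? ≠ w'[i]?).card
    using Nat.strong_induction_on generalizing w with
  | _ d ih =>
  have step (v : List A) (k : ℕ) (hwv : w ∈ L ↔ v ∈ L) (hv : v.length = w.length)
      (hocc : ∀ a c, Occurs χ v a c ↔ Occurs χ w a c) (hk : k < w'.length)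
      (hwk : w[k]? ≠ w'[k]?) (hvk : v[k]? = w'[k]?)
      (hsub : ∀ l : ℕ, w[l]? = w'[l]? → v[l]? = w'[l]?) : w ∈ L ↔ w' ∈ L := by
    refine hwv.trans (ih _ ?_ (hv.trans hlen) (fun a c => (hocc a c).trans (h a c)) rfl)
    rw [← hd]
    refine Finset.card_lt_card (Finset.ssubset_iff_of_subset ?_ |>.2 ⟨k, ?_, ?_⟩)
    · exact Finset.monotone_filter_right _ fun l _ => mt (hsub l)
    · exact Finset.mem_filter.2 ⟨Finset.mem_range.2 hk, hwk⟩
    · simp [hvk]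
  by_cases heq : w = w'
  · rw [heq]
  obtain ⟨j, hj⟩ : ∃ j, w[j]? ≠ w'[j]? := by
    by_contra! hall
    exact heq (List.ext_getElem? hall)
  have hjw' : j < w'.length := by
    by_contra! hge
    exact hj (by rw [List.getElem?_eq_none (hlen ▸ hge), List.getElem?_eq_none hge])
  have hjw : j < w.length := hlen ▸ hjw'
  obtain ⟨a, ha⟩ : ∃ a, w[j]? = some a := ⟨_, List.getElem?_eq_getElem hjw⟩
  obtain ⟨b, hb⟩ : ∃ b, w'[j]? = some b := ⟨_, List.getElem?_eq_getElem hjw'⟩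
  by_cases hdup : ∃ i, i ≠ j ∧ χ i = χ j ∧ w[i]? = some a
  · obtain ⟨i, hij, hχ, hi⟩ := hdup
    obtain ⟨k, hχ', hk⟩ := (h b (χ j)).2 ⟨j, rfl, hb⟩
    have hjk : j ≠ k := by grind
    have hik : i ≠ k := by grind
    exact step (w.set j b) j (hrep w i j k a b hij hik hjk hχ hχ'.symm hi ha hk) (by simp)
      (occurs_set_iff hij hχ hχ'.symm hi ha hk) hjw' hj (by grind) (by grind)
  · obtain ⟨i, hχ, hi⟩ := (h a (χ j)).1 ⟨j, rfl, ha⟩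
    have hij : i ≠ j := by grind
    have hiw' : i < w'.length := (List.getElem?_eq_some_iff.1 hi).1
    obtain ⟨e, he⟩ : ∃ e, w[i]? = some e := ⟨_, List.getElem?_eq_getElem (hlen ▸ hiw')⟩
    exact step ((w.set i a).set j e) i (hswap w i j e a hij hχ he ha) (by simp)
      (occurs_swap_iff hχ he ha) hiw' (by grind) (by grind) (by grind)

theorem exists_extension (happ : AppendInvariant χ L) (hlen : w.length ≤ w'.length)
    (h : ∀ a c, Occurs χ w a c ↔ Occurs χ w' a c) :
    ∃ v : List A, v.length = w'.length ∧ (w ∈ L ↔ v ∈ L) ∧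
      ∀ a c, Occurs χ v a c ↔ Occurs χ w' a c := by
  induction hd : w'.length - w.length generalizing w with
  | zero => exact ⟨w, by omega, Iff.rfl, h⟩
  | succ d ih =>
    have hlt : w.length < w'.length := by omega
    obtain ⟨i, hχ, hi⟩ :=
      (h w'[w.length] (χ w.length)).2 ⟨w.length, rfl, List.getElem?_eq_getElem hlt⟩
    obtain ⟨v, hv, hmem, hocc⟩ := ih (w := w ++ [w'[w.length]]) (by simpa using hlt)
      (fun a c => (occurs_append_iff hχ hi a c).trans (h a c)) (by simp; omega)
    exact ⟨v, hv, (happ w i _ hχ hi).trans hmem, hocc⟩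

theorem mem_iff_of_occurs_iff (hswap : SwapInvariant χ L) (hrep : ReplaceInvariant χ L)
    (happ : AppendInvariant χ L) (h : ∀ a c, Occurs χ w a c ↔ Occurs χ w' a c) :
    w ∈ L ↔ w' ∈ L := by
  wlog hlen : w.length ≤ w'.length generalizing w w'
  · exact (this (fun a c => (h a c).symm) (le_of_not_ge hlen)).symm
  obtain ⟨v, hv, hmem, hocc⟩ := exists_extension happ hlen h
  exact hmem.trans (mem_iff_of_length_eq hswap hrep hv hocc)

end Colouring

theorem SatAB.exists_finset {L : Set (List A)} {a b : A} (h : SatAB L a b) :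
    ∃ F : Finset (Set ℕ), ∀ x : Dom2 A, (∀ Q ∈ F, x.1.2.1 ∈ Q ↔ x.1.2.2 ∈ Q) →
      (f2 a b x ∈ L ↔ f2 b a x ∈ L) :=
  exists_finset_forall_mem_iff (E := fun Q => {x : Dom2 A | x.1.2.1 ∈ Q ↔ x.1.2.2 ∈ Q})
    fun ν hν => h ν (map_eq_map_of_forall_mem hν)

theorem SatAAB.exists_finset {L : Set (List A)} {a b : A} (h : SatAAB L a b) :
    ∃ F : Finset (Set ℕ), ∀ x : Dom3 A,
      (∀ Q ∈ F, (x.1.2.1 ∈ Q ↔ x.1.2.2.1 ∈ Q) ∧ (x.1.2.2.1 ∈ Q ↔ x.1.2.2.2 ∈ Q)) →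
      (f3 a a b x ∈ L ↔ f3 a b b x ∈ L) :=
  exists_finset_forall_mem_iff
    (E := fun Q => {x : Dom3 A |
      (x.1.2.1 ∈ Q ↔ x.1.2.2.1 ∈ Q) ∧ (x.1.2.2.1 ∈ Q ↔ x.1.2.2.2 ∈ Q)})
    fun ν hν => h ν
      ⟨map_eq_map_of_forall_mem fun Q => Filter.mem_of_superset (hν Q) fun _ hx => hx.1,
        map_eq_map_of_forall_mem fun Q => Filter.mem_of_superset (hν Q) fun _ hx => hx.2⟩

theorem SatAA.exists_finset {L : Set (List A)} {a : A} (h : SatAA L a) :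
    ∃ F : Finset (Set ℕ), ∀ x : Dom1 A, (∀ Q ∈ F, x.1.2 ∈ Q ↔ x.1.1.length ∈ Q) →
      (f1 a x ∈ L ↔ f1app a x ∈ L) :=
  exists_finset_forall_mem_iff (E := fun Q => {x : Dom1 A | x.1.2 ∈ Q ↔ x.1.1.length ∈ Q})
    fun ν hν => h ν (map_eq_map_of_forall_mem hν)

/-- Any language `L ⊆ A*` which satisfies the families of ultrafilter equations
`E_{ab=ba}`, `E_{aab=abb}` and `E_{a=a·a}` for all `a, b ∈ A` belongs to `B₁`. -/
theorem statement2 (A : Type*) [Fintype A] [Nonempty A] (L : Set (List A))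
    (hL : ∀ a b : A, SatAB L a b ∧ SatAAB L a b ∧ SatAA L a) : B1 A L := by
  classical
  choose F₁ hF₁ using fun p : A × A => (hL p.1 p.2).1.exists_finset
  choose F₂ hF₂ using fun p : A × A => (hL p.1 p.2).2.1.exists_finset
  choose F₃ hF₃ using fun a : A => (hL a a).2.2.exists_finset
  let F : Finset (Set ℕ) :=
    Finset.univ.biUnion F₁ ∪ Finset.univ.biUnion F₂ ∪ Finset.univ.biUnion F₃
  let χ : ℕ → Finset (Set ℕ) := fun n => F.filter (n ∈ ·)
  have hχ {i j : ℕ} (hij : χ i = χ j) {Q : Set ℕ} (hQ : Q ∈ F) : i ∈ Q ↔ j ∈ Q := by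
    simpa [χ, hQ] using congrArg (Q ∈ ·) hij
  have hF₁F (p : A × A) {Q : Set ℕ} (hQ : Q ∈ F₁ p) : Q ∈ F :=
    Finset.mem_union_left _ (Finset.mem_union_left _
      (Finset.mem_biUnion.2 ⟨p, Finset.mem_univ _, hQ⟩))
  have hF₂F (p : A × A) {Q : Set ℕ} (hQ : Q ∈ F₂ p) : Q ∈ F :=
    Finset.mem_union_left _ (Finset.mem_union_right _
      (Finset.mem_biUnion.2 ⟨p, Finset.mem_univ _, hQ⟩))
  have hF₃F (a : A) {Q : Set ℕ} (hQ : Q ∈ F₃ a) : Q ∈ F :=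
    Finset.mem_union_right _ (Finset.mem_biUnion.2 ⟨a, Finset.mem_univ _, hQ⟩)
  have hswap : SwapInvariant χ L := by
    intro w i j a b hij hc hi hj
    obtain ⟨hiw, hia⟩ := List.getElem?_eq_some_iff.1 hi
    obtain ⟨hjw, hjb⟩ := List.getElem?_eq_some_iff.1 hj
    have hwi : w.set i a = w := by rw [← hia, List.set_getElem_self]
    have hwj : w.set j b = w := by rw [← hjb, List.set_getElem_self]
    simpa [f2, hij, hwi, hwj] using
      hF₁ (a, b) ⟨(w, i, j), hiw, hjw⟩ fun Q hQ => hχ hc (hF₁F _ hQ)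
  have hrep : ReplaceInvariant χ L := by
    intro w i j k a b hij hik hjk hc hc' hi hj hk
    obtain ⟨hiw, hia⟩ := List.getElem?_eq_some_iff.1 hi
    obtain ⟨hjw, hja⟩ := List.getElem?_eq_some_iff.1 hj
    obtain ⟨hkw, hkb⟩ := List.getElem?_eq_some_iff.1 hk
    have hwi : w.set i a = w := by rw [← hia, List.set_getElem_self]
    have hwj : w.set j a = w := by rw [← hja, List.set_getElem_self]
    have hwk : w.set k b = w := by rw [← hkb, List.set_getElem_self]
    have := hF₂ (a, b) ⟨(w, i, j, k), hiw, hjw, hkw⟩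
      fun Q hQ => ⟨hχ hc (hF₂F _ hQ), hχ hc' (hF₂F _ hQ)⟩
    simpa [f3, hij, hik, hjk, hwi, hwj, hwk, List.set_comm b b hjk] using this
  have happ : AppendInvariant χ L := by
    intro w i a hc hi
    obtain ⟨hiw, hia⟩ := List.getElem?_eq_some_iff.1 hi
    have hwi : w.set i a = w := by rw [← hia, List.set_getElem_self]
    simpa [f1, f1app, hwi] using hF₃ a ⟨(w, i), hiw⟩ fun Q hQ => hχ hc (hF₃F _ hQ)
  have hdiam (w : List A) (a : A) (c : Finset (Set ℕ)) :
      w ∈ diamLang a {n | χ n = c} ↔ Occurs χ w a c :=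
    exists_congr fun i => by
      rw [Set.mem_inter_iff, mem_contentSet, Set.mem_ofPred_eq, and_comm]
  refine genBool_of_determined (D := fun p : A × Finset (Set ℕ) => diamLang p.1 {n | χ n = p.2})
    (Finset.univ ×ˢ F.powerset)
    (fun p _ => GenBool.basic (S := {L | ∃ a Q, L = diamLang a Q}) ⟨p.1, _, rfl⟩) L
    fun w w' h => ?_
  refine mem_iff_of_occurs_iff hswap hrep happ fun a c => ?_
  by_cases hc : c ∈ F.powerset
  · simpa only [hdiam] using h (a, c) (Finset.mk_mem_product (Finset.mem_univ a) hc)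
  · have hne (i : ℕ) : χ i ≠ c := by
      rintro rfl
      exact hc (Finset.mem_powerset.2 (Finset.filter_subset _ _))
    simp [Occurs, hne]

end Stmt2
end

section
/- Let A be a finite alphabet, L ⊆ A* a language, and (Q₁,...,Q_ℓ) a finite colouring of ℕ such that for all a, b ∈ A: ⋃_{i=1}^ℓ A*⊗Q_i² ⊆ E_{L,f_{a,b},f_{b,a}}, ⋃_{i=1}^ℓ A*⊗Q_i³ ⊆ E_{L,f_{a,a,b},f_{a,b,b}}, and ⋃_{i=1}^ℓ L_{Q_i}⊗Q_i ⊆ E_{L,f_a,f_a·a}. Then for any words w, w' ∈ A* with w ∼_{(Q₁,...,Q_ℓ)} w', one has w ∈ L if and only if w' ∈ L. -/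
open Set

namespace Stmt3

variable {A : Type*}

/-- `c_a(w)`: the set of positions of the word `w` carrying the letter `a`. -/
def contentSet (a : A) (w : List A) : Set ℕ :=
  {i | ∃ h : i < w.length, w.get ⟨i, h⟩ = a}

/-- `⟨w,Q⟩`: the content of the word `w` on `Q ⊆ ℕ`. -/
def wordContent (w : List A) (Q : Set ℕ) : Set A :=
  {a | (contentSet a w ∩ Q).Nonempty}

/-- `A* ⊗ ℕ`. -/
abbrev Dom1 (A : Type*) : Type _ := {x : List A × ℕ // x.2 < x.1.length}

/-- `A* ⊗ ℕ²`. -/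
abbrev Dom2 (A : Type*) : Type _ :=
  {x : List A × ℕ × ℕ // x.2.1 < x.1.length ∧ x.2.2 < x.1.length}

/-- `A* ⊗ ℕ³`. -/
abbrev Dom3 (A : Type*) : Type _ :=
  {x : List A × ℕ × ℕ × ℕ //
    x.2.1 < x.1.length ∧ x.2.2.1 < x.1.length ∧ x.2.2.2 < x.1.length}

/-- `f_{a,b}(w,j₁,j₂) = w(j₁→a)(j₂→b)` if `j₁ ≠ j₂`, and `w` otherwise. -/
def f2 (a b : A) : Dom2 A → List A := fun x =>
  if x.1.2.1 ≠ x.1.2.2 then (x.1.1.set x.1.2.1 a).set x.1.2.2 b else x.1.1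

/-- `f_{a,b,c}(w,j₁,j₂,j₃) = w(j₁→a)(j₂→b)(j₃→c)` if `j₁,j₂,j₃` are pairwise
distinct, and `w` otherwise. -/
def f3 (a b c : A) : Dom3 A → List A := fun x =>
  if x.1.2.1 ≠ x.1.2.2.1 ∧ x.1.2.1 ≠ x.1.2.2.2 ∧ x.1.2.2.1 ≠ x.1.2.2.2 then
    ((x.1.1.set x.1.2.1 a).set x.1.2.2.1 b).set x.1.2.2.2 c
  else x.1.1

/-- `f_a(w,i) = w(i→a)`. -/
def f1 (a : A) : Dom1 A → List A := fun x => x.1.1.set x.1.2 a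

/-- `f_a·a(w,i) = w(i→a).a`. -/
def f1app (a : A) : Dom1 A → List A := fun x => x.1.1.set x.1.2 a ++ [a]

/-- `E_{L,u,v} := {x : u(x) ∈ L ⟺ v(x) ∈ L}`. -/
def ESet {X : Type*} (L : Set (List A)) (u v : X → List A) : Set X :=
  {x | u x ∈ L ↔ v x ∈ L}

/-- Every letter of `w` occurs in `w'` at some position of the same colour. -/
def ContentLE {ι : Type*} (c : ℕ → ι) (w w' : List A) : Prop :=
  ∀ n a, w[n]? = some a → ∃ m, c m = c n ∧ w'[m]? = some a

lemma ContentLE.trans {ι : Type*} {c : ℕ → ι} {u v w : List A}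
    (h₁ : ContentLE c u v) (h₂ : ContentLE c v w) : ContentLE c u w := by
  intro n a hn
  obtain ⟨m, hm, hv⟩ := h₁ n a hn
  obtain ⟨k, hk, hw⟩ := h₂ m a hv
  exact ⟨k, hk.trans hm, hw⟩

lemma mem_wordContent {w : List A} {Q : Set ℕ} {a : A} :
    a ∈ wordContent w Q ↔ ∃ n ∈ Q, w[n]? = some a := by
  simp only [wordContent, contentSet, Set.Nonempty, Set.mem_inter_iff, Set.mem_ofPred_eq,
    List.get_eq_getElem, List.getElem?_eq_some_iff]
  exact exists_congr fun n => and_comm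

lemma contentLE_of_wordContent_subset {ι : Type*} {c : ℕ → ι} {Q : ι → Set ℕ}
    (hc : ∀ n i, n ∈ Q i ↔ c n = i) {w w' : List A}
    (h : ∀ i, wordContent w (Q i) ⊆ wordContent w' (Q i)) : ContentLE c w w' := by
  intro n a hn
  obtain ⟨m, hm, hw⟩ := mem_wordContent.1
    (h (c n) (mem_wordContent.2 ⟨n, (hc n _).2 rfl, hn⟩))
  exact ⟨m, (hc m _).1 hm, hw⟩

/-- The set of positions at which `w` and `w'` differ. -/
noncomputable def diffSet (w w' : List A) : Finset ℕ := by
  classical exact (Finset.range w.length).filter fun n => w[n]? ≠ w'[n]?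

lemma mem_diffSet {w w' : List A} {n : ℕ} :
    n ∈ diffSet w w' ↔ n < w.length ∧ w[n]? ≠ w'[n]? := by
  simp [diffSet]

lemma card_diffSet_lt {u u' w w' : List A} (p : ℕ) (hlen : u.length = w.length)
    (hp : p ∈ diffSet w w') (hp' : u[p]? = u'[p]?)
    (h : ∀ n : ℕ, w[n]? = w'[n]? → u[n]? = u'[n]?) :
    (diffSet u u').card < (diffSet w w').card := by
  refine Finset.card_lt_card ⟨fun n hn => ?_, fun hsub => ?_⟩
  · rw [mem_diffSet] at hn ⊢
    exact ⟨hlen ▸ hn.1, fun he => hn.2 (h n he)⟩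
  · exact (mem_diffSet.1 (hsub hp)).2 hp'

/-- Words of equal length with the same content in every colour are not separated by a language
closed under swapping letters in positions of one colour and under trading repeated letters for
letters already present in that colour. -/
lemma mem_iff_of_length_eq {ι : Type*} {c : ℕ → ι} {L : Set (List A)}
    (hswap : ∀ (w : List A) (p q : ℕ) (a b : A), c p = c q → p ≠ q →
      w[p]? = some a → w[q]? = some b → (w ∈ L ↔ (w.set p b).set q a ∈ L))
    (hdup : ∀ (w : List A) (p q r : ℕ) (a b : A), c p = c q → c r = c q →
      p ≠ q → r ≠ p → r ≠ q → w[p]? = some a → w[r]? = some a → w[q]? = some b →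
      (w ∈ L ↔ w.set p b ∈ L))
    (w w' : List A) (hlen : w.length = w'.length)
    (h : ContentLE c w w') (h' : ContentLE c w' w) : w ∈ L ↔ w' ∈ L := by
  induction hk : (diffSet w w').card using Nat.strong_induction_on generalizing w w' with
  | _ k ih =>
  subst hk
  by_cases heq : w = w'
  · rw [heq]
  obtain ⟨p, hp⟩ : ∃ p, w[p]? ≠ w'[p]? := by
    by_contra! hall
    exact heq (List.ext_getElem? hall)
  have hpw : p < w.length := by
    by_contra hge
    exact hp (by rw [List.getElem?_eq_none (by omega), List.getElem?_eq_none (by omega)])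
  have hmem : p ∈ diffSet w w' := mem_diffSet.2 ⟨hpw, hp⟩
  obtain ⟨a, ha⟩ : ∃ a, w[p]? = some a := ⟨_, List.getElem?_eq_getElem hpw⟩
  obtain ⟨b, hb⟩ : ∃ b, w'[p]? = some b := ⟨_, List.getElem?_eq_getElem (hlen ▸ hpw)⟩
  have hab : a ≠ b := by rintro rfl; exact hp (ha.trans hb.symm)
  have hpw' : p < w'.length := hlen ▸ hpw
  by_cases hq : ∃ q, c q = c p ∧ w[q]? = some b ∧ w'[q]? ≠ some b
  · obtain ⟨q, hqc, hqw, hqw'⟩ := hq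
    have hqp : p ≠ q := by rintro rfl; exact hqw' hb
    have hql : q < w.length := (List.getElem?_eq_some_iff.1 hqw).1
    have get : ∀ n, ((w.set p b).set q a)[n]? =
        if n = q then some a else if n = p then some b else w[n]? := by
      intro n
      simp only [List.getElem?_set, List.length_set]
      grind
    rw [hswap w p q a b hqc.symm hqp ha hqw]
    refine ih _ ?_ _ _ (by simpa using hlen) ?_ ?_ rfl
    · exact card_diffSet_lt p (by simp) hmem (by grind) (by grind)
    · refine ContentLE.trans (fun n x hn => ?_) h
      rw [get] at hn
      split_ifs at hn with h1 h2
      · exact ⟨p, by rw [h1, hqc], by rw [ha, hn]⟩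
      · exact ⟨q, by rw [h2, hqc], by rw [hqw, hn]⟩
      · exact ⟨n, rfl, hn⟩
    · refine h'.trans fun n x hn => ?_
      by_cases h1 : n = q
      · exact ⟨p, by rw [h1, hqc], by grind⟩
      by_cases h2 : n = p
      · exact ⟨q, by rw [h2, hqc], by grind⟩
      exact ⟨n, rfl, by grind⟩
  · push Not at hq
    obtain ⟨q, hqc, hqw⟩ := h' p b hb
    have hqw' := hq q hqc hqw
    have hqp : q ≠ p := by rintro rfl; exact hab (Option.some.inj (ha.symm.trans hqw))
    obtain ⟨s, hsc, hsw'⟩ := h p a ha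
    have hsp : p ≠ s := by rintro rfl; exact hab (Option.some.inj (hsw'.symm.trans hb))
    have hqs : q ≠ s := by rintro rfl; exact hab (Option.some.inj (hsw'.symm.trans hqw'))
    have get : ∀ n, (w'.set p a)[n]? = if n = p then some a else w'[n]? := by
      intro n
      simp only [List.getElem?_set]
      grind
    rw [hdup w' p s q b a hsc.symm (hqc.trans hsc.symm) hsp hqp hqs hb hqw' hsw']
    refine ih _ ?_ _ _ (by simpa using hlen) ?_ ?_ rfl
    · exact card_diffSet_lt p rfl hmem (by grind) (by grind)
    · refine h.trans fun n x hn => ?_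
      by_cases h1 : n = p
      · exact ⟨q, by rw [h1, hqc], by grind⟩
      exact ⟨n, rfl, by grind⟩
    · refine ContentLE.trans (fun n x hn => ?_) h'
      rw [get] at hn
      split_ifs at hn with h1
      · exact ⟨s, by rw [h1, hsc], by rw [hsw', hn]⟩
      · exact ⟨n, rfl, hn⟩

/-- A word with the same content as a longer one extends to a word of that greater length with
equivalent membership and the same content. -/
lemma exists_extension {ι : Type*} {c : ℕ → ι} {L : Set (List A)}
    (happ : ∀ (w : List A) (p : ℕ) (a : A), c p = c w.length → w[p]? = some a →
      (w ∈ L ↔ w ++ [a] ∈ L))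
    (w w' : List A) (hlen : w.length ≤ w'.length) (h' : ContentLE c w' w) :
    ∃ u : List A, u.length = w'.length ∧ (w ∈ L ↔ u ∈ L) ∧
      ContentLE c u w ∧ ContentLE c w u := by
  induction hk : w'.length - w.length generalizing w with
  | zero => exact ⟨w, by omega, Iff.rfl, fun n _ hn => ⟨n, rfl, hn⟩, fun n _ hn => ⟨n, rfl, hn⟩⟩
  | succ k ih =>
    have hlt : w.length < w'.length := by omega
    obtain ⟨p, hpc, hpw⟩ := h' w.length _ (List.getElem?_eq_getElem hlt)
    set a := w'[w.length]
    have hle : ContentLE c w (w ++ [a]) := fun n x hn =>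
      ⟨n, rfl, by rw [List.getElem?_append_left (List.getElem?_eq_some_iff.1 hn).1, hn]⟩
    have hge : ContentLE c (w ++ [a]) w := by
      intro n x hn
      by_cases hnw : n < w.length
      · exact ⟨n, rfl, by rwa [List.getElem?_append_left hnw] at hn⟩
      · have hnl := (List.getElem?_eq_some_iff.1 hn).1
        obtain rfl : n = w.length := by simp at hnl; omega
        refine ⟨p, hpc, ?_⟩
        rw [← hn, hpw]
        simp
    obtain ⟨u, hul, hu, huw, hwu⟩ := ih (w ++ [a]) (by simp; omega) (h'.trans hle) (by simp; omega)
    exact ⟨u, hul, (happ w p a hpc hpw).trans hu, huw.trans hge, hle.trans hwu⟩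

/-- Completeness, two-or-more-colour version: if `L` satisfies the reformulated
equations for a finite colouring `(Q₁,...,Q_ℓ)` of `ℕ`, then `L` cannot separate
`∼_𝒬`-equivalent words. -/
theorem statement3 (A : Type*) [Fintype A] [Nonempty A] (L : Set (List A))
    (ℓ : ℕ) (hℓ : 1 ≤ ℓ) (Q : Fin ℓ → Set ℕ)
    (hdisj : Pairwise fun i j => Disjoint (Q i) (Q j))
    (hcover : ⋃ i, Q i = Set.univ)
    (hab : ∀ a b : A,
      (⋃ i, {x : Dom2 A | x.1.2.1 ∈ Q i ∧ x.1.2.2 ∈ Q i}) ⊆ ESet L (f2 a b) (f2 b a))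
    (haab : ∀ a b : A,
      (⋃ i, {x : Dom3 A | x.1.2.1 ∈ Q i ∧ x.1.2.2.1 ∈ Q i ∧ x.1.2.2.2 ∈ Q i}) ⊆
        ESet L (f3 a a b) (f3 a b b))
    (haa : ∀ a : A,
      (⋃ i, {x : Dom1 A | x.1.2 ∈ Q i ∧ x.1.1.length ∈ Q i}) ⊆ ESet L (f1 a) (f1app a))
    (w w' : List A) (hsim : ∀ i, wordContent w (Q i) = wordContent w' (Q i)) :
    w ∈ L ↔ w' ∈ L := by
  obtain ⟨c, hc⟩ : ∃ c : ℕ → Fin ℓ, ∀ n i, n ∈ Q i ↔ c n = i := by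
    have hex : ∀ n, ∃ i, n ∈ Q i := fun n => Set.mem_iUnion.1 (hcover ▸ Set.mem_univ n)
    choose c hc using hex
    refine ⟨c, fun n i => ⟨fun hn => ?_, fun hn => hn ▸ hc n⟩⟩
    by_contra hne
    exact Set.disjoint_left.1 (hdisj hne) (hc n) hn
  have hswap : ∀ (w : List A) (p q : ℕ) (a b : A), c p = c q → p ≠ q →
      w[p]? = some a → w[q]? = some b → (w ∈ L ↔ (w.set p b).set q a ∈ L) := by
    intro w p q a b hpq hne hp hq
    obtain ⟨hpl, rfl⟩ := List.getElem?_eq_some_iff.1 hp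
    obtain ⟨hql, rfl⟩ := List.getElem?_eq_some_iff.1 hq
    have key := @hab w[p] w[q] ⟨(w, p, q), hpl, hql⟩
      (Set.mem_iUnion.2 ⟨c q, (hc _ _).2 hpq, (hc _ _).2 rfl⟩)
    simpa [ESet, f2, hne] using key
  have hdup : ∀ (w : List A) (p q r : ℕ) (a b : A), c p = c q → c r = c q →
      p ≠ q → r ≠ p → r ≠ q → w[p]? = some a → w[r]? = some a → w[q]? = some b →
      (w ∈ L ↔ w.set p b ∈ L) := by
    intro w p q r a b hpq hrq hne hrp hrq' hp hr hq
    have hpl := (List.getElem?_eq_some_iff.1 hp).1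
    have hql := (List.getElem?_eq_some_iff.1 hq).1
    have hrl := (List.getElem?_eq_some_iff.1 hr).1
    have key := @haab a b ⟨(w, r, p, q), hrl, hpl, hql⟩
      (Set.mem_iUnion.2 ⟨c q, (hc _ _).2 hrq, (hc _ _).2 hpq, (hc _ _).2 rfl⟩)
    have e₁ : ((w.set r a).set p a).set q b = w := by
      refine List.ext_getElem? fun n => ?_
      simp only [List.getElem?_set, List.length_set]
      grind
    have e₂ : ((w.set r a).set p b).set q b = w.set p b := by
      refine List.ext_getElem? fun n => ?_
      simp only [List.getElem?_set, List.length_set]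
      grind
    simpa [ESet, f3, hne, hrp, hrq', e₁, e₂] using key
  have happ : ∀ (w : List A) (p : ℕ) (a : A), c p = c w.length → w[p]? = some a →
      (w ∈ L ↔ w ++ [a] ∈ L) := by
    intro w p a hpc hp
    obtain ⟨hpl, rfl⟩ := List.getElem?_eq_some_iff.1 hp
    have key := @haa w[p] ⟨(w, p), hpl⟩
      (Set.mem_iUnion.2 ⟨c w.length, (hc _ _).2 hpc, (hc _ _).2 rfl⟩)
    simpa [ESet, f1, f1app] using key
  have h : ContentLE c w w' := contentLE_of_wordContent_subset hc fun i => (hsim i).subset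
  have h' : ContentLE c w' w := contentLE_of_wordContent_subset hc fun i => (hsim i).superset
  rcases le_total w.length w'.length with hlen | hlen
  · obtain ⟨u, hul, hu, huw, hwu⟩ := exists_extension happ w w' hlen h'
    exact hu.trans (mem_iff_of_length_eq hswap hdup u w' hul (huw.trans h) (h'.trans hwu))
  · obtain ⟨u, hul, hu, huw, hwu⟩ := exists_extension happ w' w hlen h
    exact (hu.trans (mem_iff_of_length_eq hswap hdup u w hul (huw.trans h') (h.trans hwu))).symm

end Stmt3
end
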